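/- Lower bound (eq. (3.38)): I_c + Σ_{ω : P_f(ω) > 0} P_f(ω)·χ{P_{i|f}(·|ω), ρ_f^•(ω)} ≥ χ{p, η_f^•}, where χ{P_{i|f}(·|ω), ρ_f^•(ω)} := Σ_{α : p(α,ω) > 0} P_{i|f}(α|ω)·S(ρ_f^α(ω)|ρ_f(ω)) and χ{p, η_f^•} := Σ_{α : p_α > 0} p_α·S(η_f^α|η_f). In words: the classical information extracted in the measurement plus the mean quantum information left in the a posteriori states is at least the quantum information left in the post-measurement a priori states. -/

import Mathlib

open Matrix BigOperators
open scoped Kronecker ComplexOrder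

noncomputable section

/-- A density matrix: positive semidefinite with unit trace. -/
def IsDensityMatrix {ι : Type*} [Fintype ι] (ρ : Matrix ι ι ℂ) : Prop :=
  ρ.PosSemidef ∧ ρ.trace = 1

/-- von Neumann entropy (natural logarithm), via the eigenvalues;
junk value `0` if the matrix is not Hermitian. -/
noncomputable def vnEntropy {ι : Type*} [Fintype ι] [DecidableEq ι]
    (ρ : Matrix ι ι ℂ) : ℝ :=
  if h : ρ.IsHermitian then -∑ i, h.eigenvalues i * Real.log (h.eigenvalues i) else 0

/-- Quantum relative entropy `S(σ|τ)` (natural logarithm), computed in an orthonormal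
eigenbasis of `τ`; junk value `0` if `σ` or `τ` is not Hermitian. -/
noncomputable def relEnt {ι : Type*} [Fintype ι] [DecidableEq ι]
    (σ τ : Matrix ι ι ℂ) : ℝ :=
  if h : σ.IsHermitian ∧ τ.IsHermitian then
    (∑ i, h.1.eigenvalues i * Real.log (h.1.eigenvalues i))
      - ∑ j, (if 0 < h.2.eigenvalues j then
          Real.log (h.2.eigenvalues j) *
            ((star (fun i => h.2.eigenvectorBasis j i)) ⬝ᵥ
              σ.mulVec (fun i => h.2.eigenvectorBasis j i)).re
        else 0)
  else 0

/-- Holevo χ-quantity of an ensemble of states, relative to its barycenter. -/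
noncomputable def holevoChi {ι B : Type*} [Fintype ι] [DecidableEq ι] [Fintype B]
    (q : B → ℝ) (τ : B → Matrix ι ι ℂ) : ℝ :=
  ∑ β, if 0 < q β then q β * relEnt (τ β) (∑ γ, q γ • τ γ) else 0

/-- The action of an instrument in Kraus form: `I_ω(ρ) = ∑ k, V ω k * ρ * (V ω k)ᴴ`. -/
noncomputable def instAct {n m : ℕ} {Ω K : Type*} [Fintype K]
    (V : Ω → K → Matrix (Fin m) (Fin n) ℂ) (ω : Ω)
    (ρ : Matrix (Fin n) (Fin n) ℂ) : Matrix (Fin m) (Fin m) ℂ :=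
  ∑ k, V ω k * ρ * (V ω k)ᴴ

/-- The POVM associated with an instrument in Kraus form: `E_ω = ∑ k, (V ω k)ᴴ * V ω k`. -/
noncomputable def povm {n m : ℕ} {Ω K : Type*} [Fintype K]
    (V : Ω → K → Matrix (Fin m) (Fin n) ℂ) (ω : Ω) : Matrix (Fin n) (Fin n) ℂ :=
  ∑ k, (V ω k)ᴴ * V ω k

/-- Outcome probability `Tr(E_ω ρ)`. -/
noncomputable def probOut {n m : ℕ} {Ω K : Type*} [Fintype K]
    (V : Ω → K → Matrix (Fin m) (Fin n) ℂ) (ρ : Matrix (Fin n) (Fin n) ℂ) (ω : Ω) : ℝ :=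
  ((povm V ω * ρ).trace).re

/-- The a posteriori state `π_ρ(ω) = I_ω(ρ)/Tr(I_ω(ρ))` (junk if the trace vanishes). -/
noncomputable def post {n m : ℕ} {Ω K : Type*} [Fintype K]
    (V : Ω → K → Matrix (Fin m) (Fin n) ℂ) (ω : Ω)
    (ρ : Matrix (Fin n) (Fin n) ℂ) : Matrix (Fin m) (Fin m) ℂ :=
  (((instAct V ω ρ).trace.re)⁻¹ : ℝ) • instAct V ω ρ

/-- The classical (Shannon) input/output mutual information of the ensemble `(p, ρ)`
measured with the POVM of the instrument `V`. -/
noncomputable def Ic {n m : ℕ} {A Ω K : Type*} [Fintype A] [Fintype Ω] [Fintype K]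
    (p : A → ℝ) (ρ : A → Matrix (Fin n) (Fin n) ℂ)
    (V : Ω → K → Matrix (Fin m) (Fin n) ℂ) : ℝ :=
  ∑ α, ∑ ω,
    if 0 < p α * probOut V (ρ α) ω then
      p α * probOut V (ρ α) ω *
        Real.log ((p α * probOut V (ρ α) ω) /
          (p α * probOut V (∑ β, p β • ρ β) ω))
    else 0

/-- Quantum information gain of the instrument `V` at the state `ρ`. -/
noncomputable def infoGain {n m : ℕ} {Ω K : Type*} [Fintype Ω] [Fintype K]
    (V : Ω → K → Matrix (Fin m) (Fin n) ℂ) (ρ : Matrix (Fin n) (Fin n) ℂ) : ℝ :=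
  vnEntropy ρ - ∑ ω, if 0 < (instAct V ω ρ).trace.re then
    (instAct V ω ρ).trace.re * vnEntropy (post V ω ρ) else 0

/-- The linear functionals of `(σ, τ)` whose supremum over `X` is the quadratic form of the
resolvent at `x` of the relative modular operator of `σ` and `τ`, evaluated at `τ - σ`. -/
def resolventFunctional {ι : Type*} [Fintype ι] (x : ℝ) (σ τ X : Matrix ι ι ℂ) : ℝ :=
  (Xᴴ * (2 • (τ - σ) - τ * X - x • (X * σ))).trace.re

theorem resolventFunctional_sum {ι Ω : Type*} [Fintype ι] [Fintype Ω] (x : ℝ)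
    (σ τ : Ω → Matrix ι ι ℂ) (X : Matrix ι ι ℂ) :
    resolventFunctional x (∑ ω, σ ω) (∑ ω, τ ω) X =
      ∑ ω, resolventFunctional x (σ ω) (τ ω) X := by
  simp only [resolventFunctional, ← Complex.re_sum, ← trace_sum, ← Matrix.mul_sum,
    Finset.sum_sub_distrib, ← Finset.smul_sum, ← Matrix.sum_mul]

/-- The unitary matrix `U` diagonalizes `A`, with real eigenvalues `a`. -/
structure Diagonalizes {ι : Type*} [Fintype ι] [DecidableEq ι]
    (U : Matrix ι ι ℂ) (a : ι → ℝ) (A : Matrix ι ι ℂ) : Prop where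
  left : Uᴴ * U = 1
  right : U * Uᴴ = 1
  eq : A = U * diagonal (fun i => (a i : ℂ)) * Uᴴ

section Diagonalization

open MeasureTheory Set Filter Topology

variable {ι : Type*} [Fintype ι] [DecidableEq ι]

theorem Matrix.IsHermitian.diagonalizes {A : Matrix ι ι ℂ} (hA : A.IsHermitian) :
    Diagonalizes (hA.eigenvectorUnitary : Matrix ι ι ℂ) hA.eigenvalues A where
  left := Unitary.coe_star_mul_self _
  right := Unitary.coe_mul_star_self _
  eq := by
    conv_lhs => rw [hA.spectral_theorem, Unitary.conjStarAlgAut_apply]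
    rfl

theorem Diagonalizes.isHermitian {U A : Matrix ι ι ℂ} {a : ι → ℝ} (h : Diagonalizes U a A) :
    A.IsHermitian := by
  have hd : (diagonal (fun i => (a i : ℂ)))ᴴ = diagonal (fun i => (a i : ℂ)) := by
    rw [diagonal_conjTranspose]
    congr 1
    ext i
    simp
  rw [Matrix.IsHermitian, h.eq]
  simp [conjTranspose_mul, hd, Matrix.mul_assoc]

theorem Diagonalizes.conj_eq {U A : Matrix ι ι ℂ} {a : ι → ℝ} (h : Diagonalizes U a A) :
    Uᴴ * A * U = diagonal (fun i => (a i : ℂ)) := by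
  rw [h.eq]
  calc Uᴴ * (U * diagonal (fun i => (a i : ℂ)) * Uᴴ) * U
      = (Uᴴ * U) * diagonal (fun i => (a i : ℂ)) * (Uᴴ * U) := by simp only [Matrix.mul_assoc]
    _ = _ := by rw [h.left, Matrix.one_mul, Matrix.mul_one]

theorem Diagonalizes.smul {U A : Matrix ι ι ℂ} {a : ι → ℝ} (h : Diagonalizes U a A) (c : ℝ) :
    Diagonalizes U (fun i => c * a i) (c • A) where
  left := h.left
  right := h.right
  eq := by
    have hd : diagonal (fun i => ((c * a i : ℝ) : ℂ)) = c • diagonal (fun i => (a i : ℂ)) := by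
      rw [← diagonal_smul]
      congr 1
      ext i
      simp
    rw [hd, Matrix.mul_smul, Matrix.smul_mul, ← h.eq]

/-- Functions of a diagonalizable matrix do not depend on the diagonalization. -/
theorem Diagonalizes.functional_eq {U V A : Matrix ι ι ℂ} {a b : ι → ℝ}
    (hU : Diagonalizes U a A) (hV : Diagonalizes V b A) (f : ℝ → ℝ) :
    U * diagonal (fun i => (f (a i) : ℂ)) * Uᴴ = V * diagonal (fun i => (f (b i) : ℂ)) * Vᴴ := by
  have h1 : (Vᴴ * U) * diagonal (fun i => (a i : ℂ)) =
      diagonal (fun i => (b i : ℂ)) * (Vᴴ * U) := by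
    rw [← hU.conj_eq, ← hV.conj_eq]
    calc Vᴴ * U * (Uᴴ * A * U) = Vᴴ * (U * Uᴴ) * A * U := by simp only [Matrix.mul_assoc]
      _ = Vᴴ * A * (V * Vᴴ) * U := by rw [hU.right, hV.right, Matrix.mul_one, Matrix.mul_one]
      _ = _ := by simp only [Matrix.mul_assoc]
  have h2 : (Vᴴ * U) * diagonal (fun i => (f (a i) : ℂ)) =
      diagonal (fun i => (f (b i) : ℂ)) * (Vᴴ * U) := by
    ext j i
    have h3 := congrFun (congrFun h1 j) i
    rw [mul_diagonal, diagonal_mul] at h3 ⊢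
    by_cases h0 : (Vᴴ * U) j i = 0
    · simp [h0]
    · have h4 : (a i : ℂ) = b j := mul_left_cancel₀ h0 (by rw [h3, mul_comm])
      rw [Complex.ofReal_injective h4, mul_comm]
  calc U * diagonal (fun i => (f (a i) : ℂ)) * Uᴴ
      = (V * Vᴴ) * U * diagonal (fun i => (f (a i) : ℂ)) * Uᴴ := by
        rw [hV.right, Matrix.one_mul]
    _ = V * ((Vᴴ * U) * diagonal (fun i => (f (a i) : ℂ))) * Uᴴ := by
        simp only [Matrix.mul_assoc]
    _ = V * (diagonal (fun i => (f (b i) : ℂ))) * Vᴴ * (U * Uᴴ) := by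
        rw [h2]; simp only [Matrix.mul_assoc]
    _ = _ := by rw [hU.right, Matrix.mul_one]

theorem trace_mul_diagonal_mul_conjTranspose (V σ : Matrix ι ι ℂ) (d : ι → ℝ) :
    (V * diagonal (fun i => (d i : ℂ)) * Vᴴ * σ).trace.re =
      ∑ j, d j * ((Vᴴ * σ * V) j j).re := by
  have h : (V * diagonal (fun i => (d i : ℂ)) * Vᴴ * σ).trace =
      (diagonal (fun i => (d i : ℂ)) * (Vᴴ * σ * V)).trace := by
    rw [Matrix.mul_assoc, Matrix.mul_assoc, trace_mul_comm]
    simp only [Matrix.mul_assoc]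
  rw [h, trace, Complex.re_sum]
  simp [diag, diagonal_mul]

theorem Diagonalizes.trace_functional {U A : Matrix ι ι ℂ} {a : ι → ℝ}
    (h : Diagonalizes U a A) (f : ℝ → ℝ) :
    (U * diagonal (fun i => (f (a i) : ℂ)) * Uᴴ).trace.re = ∑ i, f (a i) := by
  have := trace_mul_diagonal_mul_conjTranspose U 1 (fun i => f (a i))
  simpa [h.left] using this

theorem Diagonalizes.trace_re {U A : Matrix ι ι ℂ} {a : ι → ℝ} (h : Diagonalizes U a A) :
    A.trace.re = ∑ i, a i := by
  have := h.trace_functional id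
  simpa [← h.eq] using this

theorem Diagonalizes.re_conj_apply_self {U A : Matrix ι ι ℂ} {a : ι → ℝ}
    (h : Diagonalizes U a A) (V : Matrix ι ι ℂ) (j : ι) :
    ((Vᴴ * A * V) j j).re = ∑ i, Complex.normSq ((Vᴴ * U) j i) * a i := by
  have h1 : Vᴴ * A * V = (Vᴴ * U) * diagonal (fun i => (a i : ℂ)) * (Vᴴ * U)ᴴ := by
    rw [h.eq]
    simp [conjTranspose_mul, Matrix.mul_assoc]
  rw [h1, mul_apply, Complex.re_sum]
  refine Finset.sum_congr rfl fun i _ => ?_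
  rw [mul_diagonal, conjTranspose_apply, mul_right_comm, Complex.star_def, Complex.mul_conj,
    ← Complex.ofReal_mul, Complex.ofReal_re]

theorem sum_normSq_row_of_mul_conjTranspose {W : Matrix ι ι ℂ} (h : W * Wᴴ = 1) (j : ι) :
    ∑ i, Complex.normSq (W j i) = 1 := by
  have h1 := congrArg Complex.re (congrFun (congrFun h j) j)
  rw [mul_apply, Complex.re_sum] at h1
  simpa [Complex.mul_conj] using h1

theorem sum_normSq_col_of_conjTranspose_mul {W : Matrix ι ι ℂ} (h : Wᴴ * W = 1) (i : ι) :
    ∑ j, Complex.normSq (W j i) = 1 := by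
  have h1 := sum_normSq_row_of_mul_conjTranspose (W := Wᴴ) (by rwa [conjTranspose_conjTranspose]) i
  simpa [conjTranspose_apply] using h1

/-- The quantum relative entropy can be computed in any diagonalization. -/
theorem Diagonalizes.relEnt_eq {U V σ τ : Matrix ι ι ℂ} {s t : ι → ℝ}
    (hσ : Diagonalizes U s σ) (hτ : Diagonalizes V t τ) :
    relEnt σ τ = ∑ i, s i * Real.log (s i) -
      ∑ j, if 0 < t j then Real.log (t j) * ((Vᴴ * σ * V) j j).re else 0 := by
  have h : σ.IsHermitian ∧ τ.IsHermitian := ⟨hσ.isHermitian, hτ.isHermitian⟩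
  rw [relEnt, dif_pos h]
  congr 1
  · have h1 := hσ.trace_functional (fun x => x * Real.log x)
    have h2 := h.1.diagonalizes.trace_functional (fun x => x * Real.log x)
    rw [← h1, ← h2, hσ.functional_eq h.1.diagonalizes (fun x => x * Real.log x)]
  · have h1 := trace_mul_diagonal_mul_conjTranspose V σ
      (fun j => (fun x => if 0 < x then Real.log x else 0) (t j))
    have h2 := trace_mul_diagonal_mul_conjTranspose (h.2.eigenvectorUnitary : Matrix ι ι ℂ) σ
      (fun j => (fun x => if 0 < x then Real.log x else 0) (h.2.eigenvalues j))
    rw [hτ.functional_eq h.2.diagonalizes (fun x => if 0 < x then Real.log x else 0), h2] at h1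
    simp only [ite_mul, zero_mul] at h1
    rw [← h1]
    refine Finset.sum_congr rfl fun j _ => ?_
    split_ifs
    · congr 2
      rw [Matrix.mul_assoc, mul_apply]
      rfl
    · rfl

section ScalarIntegral

variable {s t : ℝ}

theorem hasDerivAt_relEnt_primitive (hs : 0 ≤ s) (ht : 0 < t) {x : ℝ} (hx : 0 ≤ x) :
    HasDerivAt (fun y => s * Real.log (s + (t - s) / (1 + y)) - (t - s) / (1 + y))
      ((t - s) ^ 2 / (t + x * s) / (1 + x) ^ 2) x := by
  have h1 : 0 < 1 + x := by linarith
  have h2 : 0 < t + x * s := by positivity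
  have h3 : s + (t - s) / (1 + x) = (t + x * s) / (1 + x) := by
    field_simp
    ring
  have hw : HasDerivAt (fun y : ℝ => (t - s) / (1 + y)) (-(t - s) / (1 + x) ^ 2) x := by
    have := ((hasDerivAt_id x).const_add 1).inv h1.ne'
    convert! this.const_mul (t - s) using 1
    simp only [id]
    ring
  have h4 : s + (t - s) / (1 + x) ≠ 0 := by rw [h3]; positivity
  convert! (((hw.const_add s).log h4).const_mul s).sub hw using 1
  rw [h3]
  field_simp
  ring

theorem tendsto_relEnt_primitive (s t : ℝ) :
    Tendsto (fun y => s * Real.log (s + (t - s) / (1 + y)) - (t - s) / (1 + y)) atTop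
      (𝓝 (s * Real.log s)) := by
  have hw : Tendsto (fun y : ℝ => (t - s) / (1 + y)) atTop (𝓝 0) :=
    Tendsto.div_atTop tendsto_const_nhds (tendsto_atTop_add_const_left _ _ tendsto_id)
  rcases eq_or_ne s 0 with rfl | hs
  · simpa using hw.neg
  · have h1 := ((hw.const_add s).log (by simpa using hs)).const_mul s |>.sub hw
    simpa using h1

theorem integrableOn_and_integral_relEnt_kernel (hs : 0 ≤ s) (ht : 0 ≤ t) (h : t = 0 → s = 0) :
    IntegrableOn (fun x => (t - s) ^ 2 / (t + x * s) / (1 + x) ^ 2) (Ioi 0) ∧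
      ∫ x in Ioi (0 : ℝ), (t - s) ^ 2 / (t + x * s) / (1 + x) ^ 2 =
        s * Real.log s - s * Real.log t + t - s := by
  rcases ht.eq_or_lt with rfl | ht
  · simp [h rfl]
  · have hd : ∀ x ∈ Ici (0 : ℝ), HasDerivAt
        (fun y => s * Real.log (s + (t - s) / (1 + y)) - (t - s) / (1 + y))
        ((t - s) ^ 2 / (t + x * s) / (1 + x) ^ 2) x := fun x hx =>
      hasDerivAt_relEnt_primitive hs ht hx
    have hpos : ∀ x ∈ Ioi (0 : ℝ), 0 ≤ (t - s) ^ 2 / (t + x * s) / (1 + x) ^ 2 := by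
      intro x hx
      have : 0 < x := hx
      positivity
    refine ⟨integrableOn_Ioi_deriv_of_nonneg' hd hpos (tendsto_relEnt_primitive s t), ?_⟩
    rw [integral_Ioi_of_hasDerivAt_of_nonneg' hd hpos (tendsto_relEnt_primitive s t)]
    norm_num
    ring

end ScalarIntegral

theorem resolventFunctional_eq_sum {U V σ τ : Matrix ι ι ℂ} {s t : ι → ℝ}
    (hσ : Diagonalizes U s σ) (hτ : Diagonalizes V t τ) (x : ℝ) (X : Matrix ι ι ℂ) :
    resolventFunctional x σ τ X = ∑ i, ∑ j, (star ((Vᴴ * X * U) j i) *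
      (2 * (t j - s i) * (Vᴴ * U) j i - (t j + x * s i) * (Vᴴ * X * U) j i)).re := by
  have h1 : Vᴴ * τ = diagonal (fun j => (t j : ℂ)) * Vᴴ := by
    rw [← hτ.conj_eq, Matrix.mul_assoc, hτ.right, Matrix.mul_one]
  have h2 : σ * U = U * diagonal (fun j => (s j : ℂ)) := by
    rw [← hσ.conj_eq, ← Matrix.mul_assoc, ← Matrix.mul_assoc, hσ.right, Matrix.one_mul]
  set Z := 2 • (τ - σ) - τ * X - x • (X * σ) with hZ
  have h3 : Vᴴ * Z * U = 2 • (diagonal (fun j => (t j : ℂ)) * (Vᴴ * U) -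
      (Vᴴ * U) * diagonal (fun j => (s j : ℂ))) - diagonal (fun j => (t j : ℂ)) * (Vᴴ * X * U) -
      x • ((Vᴴ * X * U) * diagonal (fun j => (s j : ℂ))) := by
    simp only [hZ, Matrix.mul_sub, Matrix.sub_mul, Matrix.mul_smul, Matrix.smul_mul,
      Matrix.mul_assoc, h2]
    simp only [← Matrix.mul_assoc, h1]
  have h4 : (Xᴴ * Z).trace = ((Vᴴ * X * U)ᴴ * (Vᴴ * Z * U)).trace := by
    simp only [conjTranspose_mul, conjTranspose_conjTranspose]
    calc (Xᴴ * Z).trace = (Xᴴ * (V * Vᴴ) * Z * (U * Uᴴ)).trace := by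
          rw [hτ.right, hσ.right, Matrix.mul_one, Matrix.mul_one]
      _ = ((Xᴴ * (V * Vᴴ) * Z * U) * Uᴴ).trace := by simp only [Matrix.mul_assoc]
      _ = _ := by rw [trace_mul_comm]; simp only [Matrix.mul_assoc]
  rw [resolventFunctional, ← hZ, h4, trace, Complex.re_sum]
  refine Finset.sum_congr rfl fun i _ => ?_
  rw [diag_apply, mul_apply, Complex.re_sum]
  refine Finset.sum_congr rfl fun j _ => ?_
  rw [conjTranspose_apply, h3]
  congr 2
  simp only [Matrix.sub_apply, Matrix.smul_apply, diagonal_mul, mul_diagonal, two_nsmul,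
    Matrix.add_apply, Complex.real_smul]
  ring

theorem Complex.re_star_mul_two_mul_sub_le {c d : ℝ} (hc : 0 ≤ c) (h : c = 0 → d = 0) (m y : ℂ) :
    (star y * (2 * d * m - c * y)).re ≤ Complex.normSq m * (d ^ 2 / c) := by
  rcases hc.eq_or_lt with rfl | hc
  · simp [h rfl]
  · have h1 : Complex.normSq m * (d ^ 2 / c) - (star y * (2 * d * m - c * y)).re =
        Complex.normSq (d * m - c * y) / c := by
      simp [Complex.normSq_apply]
      field_simp
      ring
    have h2 : 0 ≤ Complex.normSq (d * m - c * y) / c := div_nonneg (Complex.normSq_nonneg _) hc.le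
    linarith

theorem Complex.re_star_mul_two_mul_sub_eq (c d : ℝ) (m : ℂ) :
    (star (((d / c : ℝ) : ℂ) * m) * (2 * d * m - c * (((d / c : ℝ) : ℂ) * m))).re =
      Complex.normSq m * (d ^ 2 / c) := by
  rcases eq_or_ne c 0 with rfl | hc
  · simp
  · simp [Complex.normSq_apply, -Complex.ofReal_div]
    field_simp
    ring

theorem isGreatest_resolventFunctional {U V σ τ : Matrix ι ι ℂ} {s t : ι → ℝ}
    (hσ : Diagonalizes U s σ) (hτ : Diagonalizes V t τ) (hs : ∀ i, 0 ≤ s i) (ht : ∀ j, 0 ≤ t j)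
    {x : ℝ} (hx : 0 < x) :
    IsGreatest (range (resolventFunctional x σ τ))
      (∑ i, ∑ j, Complex.normSq ((Vᴴ * U) j i) * ((t j - s i) ^ 2 / (t j + x * s i))) := by
  constructor
  · set Y : Matrix ι ι ℂ :=
      of fun j i => (((t j - s i) / (t j + x * s i) : ℝ) : ℂ) * (Vᴴ * U) j i with hY
    refine ⟨V * Y * Uᴴ, ?_⟩
    have h1 : Vᴴ * (V * Y * Uᴴ) * U = Y := by
      calc Vᴴ * (V * Y * Uᴴ) * U = (Vᴴ * V) * Y * (Uᴴ * U) := by simp only [Matrix.mul_assoc]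
        _ = Y := by rw [hτ.left, hσ.left, Matrix.one_mul, Matrix.mul_one]
    rw [resolventFunctional_eq_sum hσ hτ, h1]
    refine Finset.sum_congr rfl fun i _ => Finset.sum_congr rfl fun j _ => ?_
    rw [hY, of_apply, ← Complex.re_star_mul_two_mul_sub_eq]
    push_cast
    rfl
  · rintro _ ⟨X, rfl⟩
    rw [resolventFunctional_eq_sum hσ hτ]
    refine Finset.sum_le_sum fun i _ => Finset.sum_le_sum fun j _ => ?_
    have h1 : 0 ≤ x * s i := mul_nonneg hx.le (hs i)
    have h2 := Complex.re_star_mul_two_mul_sub_le (add_nonneg (ht j) h1) (d := t j - s i) (by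
      intro h
      have h3 : t j = 0 := by linarith [ht j]
      have h4 : x * s i = 0 := by linarith [ht j]
      rw [h3, (mul_eq_zero.1 h4).resolve_left hx.ne', sub_zero]) ((Vᴴ * U) j i) ((Vᴴ * X * U) j i)
    push_cast at h2
    exact h2

/-- If `τ - c • σ` is positive semidefinite for some `c > 0`, then kernel vectors of `τ` are
orthogonal to the range of `σ`. -/
theorem Diagonalizes.normSq_mul_eq_zero {U V σ τ : Matrix ι ι ℂ} {s t : ι → ℝ}
    (hσ : Diagonalizes U s σ) (hτ : Diagonalizes V t τ) (hs : ∀ i, 0 ≤ s i) {c : ℝ} (hc : 0 < c)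
    (hdom : (τ - c • σ).PosSemidef) {j : ι} (hj : t j = 0) (i : ι) :
    Complex.normSq ((Vᴴ * U) j i) * s i = 0 := by
  have h1 := (Complex.nonneg_iff.1 ((hdom.conjTranspose_mul_mul_same V).diag_nonneg (i := j))).1
  have h2 : (Vᴴ * (τ - c • σ) * V) j j = t j - c * (Vᴴ * σ * V) j j := by
    rw [Matrix.mul_sub, Matrix.sub_mul, hτ.conj_eq]
    simp
  rw [h2, hj] at h1
  have h3 : 0 ≤ -(c * ((Vᴴ * σ * V) j j).re) := by simpa using h1
  rw [hσ.re_conj_apply_self V j] at h3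
  have h4 : ∀ i ∈ Finset.univ, 0 ≤ Complex.normSq ((Vᴴ * U) j i) * s i := fun i _ =>
    mul_nonneg (Complex.normSq_nonneg _) (hs i)
  have h5 : ∑ i, Complex.normSq ((Vᴴ * U) j i) * s i = 0 := by
    have := Finset.sum_nonneg h4
    nlinarith
  exact (Finset.sum_eq_zero_iff_of_nonneg h4).1 h5 i (Finset.mem_univ i)

theorem Diagonalizes.relEnt_eq_sum {U V σ τ : Matrix ι ι ℂ} {s t : ι → ℝ}
    (hσ : Diagonalizes U s σ) (hτ : Diagonalizes V t τ) (ht : ∀ j, 0 ≤ t j) :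
    relEnt σ τ = σ.trace.re - τ.trace.re + ∑ i, ∑ j, Complex.normSq ((Vᴴ * U) j i) *
      (s i * Real.log (s i) - s i * Real.log (t j) + t j - s i) := by
  have hW1 : (Vᴴ * U) * (Vᴴ * U)ᴴ = 1 := by
    rw [conjTranspose_mul, conjTranspose_conjTranspose, Matrix.mul_assoc, ← Matrix.mul_assoc U,
      hσ.right, Matrix.one_mul, hτ.left]
  have hW2 : (Vᴴ * U)ᴴ * (Vᴴ * U) = 1 := by
    rw [conjTranspose_mul, conjTranspose_conjTranspose, Matrix.mul_assoc, ← Matrix.mul_assoc V,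
      hτ.right, Matrix.one_mul, hσ.left]
  have hcol (f : ι → ℝ) : ∑ i, ∑ j, Complex.normSq ((Vᴴ * U) j i) * f i = ∑ i, f i := by
    simp_rw [← Finset.sum_mul, sum_normSq_col_of_conjTranspose_mul hW2, one_mul]
  have hrow (f : ι → ℝ) : ∑ i, ∑ j, Complex.normSq ((Vᴴ * U) j i) * f j = ∑ j, f j := by
    rw [Finset.sum_comm]
    simp_rw [← Finset.sum_mul, sum_normSq_row_of_mul_conjTranspose hW1, one_mul]
  have hlog : (∑ j, if 0 < t j then Real.log (t j) * ((Vᴴ * σ * V) j j).re else 0) =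
      ∑ i, ∑ j, Complex.normSq ((Vᴴ * U) j i) * (s i * Real.log (t j)) := by
    rw [Finset.sum_comm]
    refine Finset.sum_congr rfl fun j _ => ?_
    rw [hσ.re_conj_apply_self V j]
    split_ifs with h
    · rw [Finset.mul_sum]
      exact Finset.sum_congr rfl fun i _ => by ring
    · simp [le_antisymm (not_lt.1 h) (ht j)]
  rw [hσ.relEnt_eq hτ, hlog, hσ.trace_re, hτ.trace_re]
  simp only [mul_add, mul_sub, Finset.sum_add_distrib, Finset.sum_sub_distrib, hrow, hcol]
  have h1 := hcol fun i => s i * Real.log (s i)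
  have h2 := hcol s
  linarith

/-- Integral representation of the relative entropy, with an integrand that is a supremum of
linear functionals. -/
theorem exists_relEnt_integral_representation {σ τ : Matrix ι ι ℂ} (hσ : σ.PosSemidef)
    (hτ : τ.PosSemidef) {c : ℝ} (hc : 0 < c) (hdom : (τ - c • σ).PosSemidef) :
    ∃ q : ℝ → ℝ, IntegrableOn (fun x => q x / (1 + x) ^ 2) (Ioi 0) ∧
      relEnt σ τ = σ.trace.re - τ.trace.re + ∫ x in Ioi (0 : ℝ), q x / (1 + x) ^ 2 ∧
      ∀ x, 0 < x → IsGreatest (range (resolventFunctional x σ τ)) (q x) := by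
  have hU := hσ.isHermitian.diagonalizes
  have hV := hτ.isHermitian.diagonalizes
  have hs := hσ.eigenvalues_nonneg
  have ht := hτ.eigenvalues_nonneg
  generalize hσ.isHermitian.eigenvalues = s at hU hs
  generalize hτ.isHermitian.eigenvalues = t at hV ht
  generalize (hσ.isHermitian.eigenvectorUnitary : Matrix ι ι ℂ) = U at hU
  generalize (hτ.isHermitian.eigenvectorUnitary : Matrix ι ι ℂ) = V at hV
  have hker (i j : ι) : IntegrableOn (fun x => Complex.normSq ((Vᴴ * U) j i) *
        ((t j - s i) ^ 2 / (t j + x * s i)) / (1 + x) ^ 2) (Ioi 0) ∧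
      ∫ x in Ioi (0 : ℝ), Complex.normSq ((Vᴴ * U) j i) *
        ((t j - s i) ^ 2 / (t j + x * s i)) / (1 + x) ^ 2 = Complex.normSq ((Vᴴ * U) j i) *
          (s i * Real.log (s i) - s i * Real.log (t j) + t j - s i) := by
    by_cases h0 : Complex.normSq ((Vᴴ * U) j i) = 0
    · simp [h0]
    · have h1 := integrableOn_and_integral_relEnt_kernel (hs i) (ht j) fun hj =>
        (mul_eq_zero.1 (hU.normSq_mul_eq_zero hV hs hc hdom hj i)).resolve_left h0
      simp only [mul_div_assoc (Complex.normSq _)]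
      refine ⟨h1.1.const_mul _, ?_⟩
      rw [integral_const_mul, h1.2]
  have hint (i : ι) : IntegrableOn (fun x => ∑ j, Complex.normSq ((Vᴴ * U) j i) *
      ((t j - s i) ^ 2 / (t j + x * s i)) / (1 + x) ^ 2) (Ioi 0) :=
    integrable_finsetSum _ fun j _ => (hker i j).1
  refine ⟨fun x => ∑ i, ∑ j, Complex.normSq ((Vᴴ * U) j i) *
    ((t j - s i) ^ 2 / (t j + x * s i)), ?_, ?_,
    fun x hx => isGreatest_resolventFunctional hU hV hs ht hx⟩
  · simp only [Finset.sum_div]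
    exact integrable_finsetSum _ fun i _ => hint i
  · simp only [Finset.sum_div]
    rw [hU.relEnt_eq_sum hV ht, integral_finsetSum _ fun i _ => hint i]
    congr 1
    refine Finset.sum_congr rfl fun i _ => ?_
    rw [integral_finsetSum _ fun j _ => (hker i j).1]
    exact Finset.sum_congr rfl fun j _ => (hker i j).2.symm

/-- The quantum relative entropy is subadditive on positive semidefinite matrices; together with
its homogeneity this is joint convexity. -/
theorem relEnt_sum_le {Ω : Type*} [Fintype Ω] {σ τ : Ω → Matrix ι ι ℂ}
    (hσ : ∀ ω, (σ ω).PosSemidef) (hτ : ∀ ω, (τ ω).PosSemidef) {c : ℝ} (hc : 0 < c)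
    (hdom : ∀ ω, (τ ω - c • σ ω).PosSemidef) :
    relEnt (∑ ω, σ ω) (∑ ω, τ ω) ≤ ∑ ω, relEnt (σ ω) (τ ω) := by
  have hdom' : (∑ ω, τ ω - c • ∑ ω, σ ω).PosSemidef := by
    rw [Finset.smul_sum, ← Finset.sum_sub_distrib]
    exact posSemidef_sum _ fun ω _ => hdom ω
  obtain ⟨q, hq, hqe, hqg⟩ := exists_relEnt_integral_representation
    (posSemidef_sum _ fun ω _ => hσ ω) (posSemidef_sum _ fun ω _ => hτ ω) hc hdom'
  choose r hr hre hrg using fun ω =>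
    exists_relEnt_integral_representation (hσ ω) (hτ ω) hc (hdom ω)
  have hle : ∫ x in Ioi (0 : ℝ), q x / (1 + x) ^ 2 ≤
      ∑ ω, ∫ x in Ioi (0 : ℝ), r ω x / (1 + x) ^ 2 := by
    rw [← integral_finsetSum _ fun ω _ => hr ω]
    refine setIntegral_mono_on hq (integrable_finsetSum _ fun ω _ => hr ω) measurableSet_Ioi
      fun x hx => ?_
    rw [← Finset.sum_div]
    gcongr
    obtain ⟨X, hX⟩ := (hqg x hx).1
    rw [← hX, resolventFunctional_sum]
    exact Finset.sum_le_sum fun ω _ => (hrg ω x hx).2 ⟨X, rfl⟩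
  rw [hqe]
  simp only [hre, Finset.sum_add_distrib, Finset.sum_sub_distrib, trace_sum, Complex.re_sum]
  linarith

/-- Scaling behaviour of the quantum relative entropy. -/
theorem relEnt_smul_smul {σ τ : Matrix ι ι ℂ} (hσ : σ.PosSemidef) (hτ : τ.PosSemidef)
    {c : ℝ} (hc : 0 < c) (hdom : (τ - c • σ).PosSemidef) {a b : ℝ} (ha : 0 < a) (hb : 0 < b) :
    relEnt (a • σ) (b • τ) =
      a * relEnt σ τ + a * (Real.log a - Real.log b) * σ.trace.re := by
  have hU := hσ.isHermitian.diagonalizes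
  have hV := hτ.isHermitian.diagonalizes
  have hs := hσ.eigenvalues_nonneg
  have ht := hτ.eigenvalues_nonneg
  generalize hσ.isHermitian.eigenvalues = s at hU hs
  generalize hτ.isHermitian.eigenvalues = t at hV ht
  generalize (hσ.isHermitian.eigenvectorUnitary : Matrix ι ι ℂ) = U at hU
  generalize (hτ.isHermitian.eigenvectorUnitary : Matrix ι ι ℂ) = V at hV
  have htr : ∑ j, ((Vᴴ * σ * V) j j).re = σ.trace.re := by
    have h1 := trace_mul_diagonal_mul_conjTranspose V σ (fun _ => 1)
    simpa [hV.right] using h1.symm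
  have hlog (x y : ℝ) (hx : 0 < x) (hy : 0 ≤ y) :
      x * y * Real.log (x * y) = x * (y * Real.log y) + x * Real.log x * y := by
    rcases hy.eq_or_lt with rfl | hy
    · simp
    · rw [Real.log_mul hx.ne' hy.ne']
      ring
  have hsum : (∑ j, if 0 < b * t j then
        Real.log (b * t j) * ((Vᴴ * (a • σ) * V) j j).re else 0) =
      a * (∑ j, if 0 < t j then Real.log (t j) * ((Vᴴ * σ * V) j j).re else 0) +
        a * Real.log b * σ.trace.re := by
    rw [← htr, Finset.mul_sum, Finset.mul_sum, ← Finset.sum_add_distrib]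
    refine Finset.sum_congr rfl fun j _ => ?_
    rcases (ht j).eq_or_lt with h | h
    · have h1 : ((Vᴴ * σ * V) j j).re = 0 := by
        rw [hU.re_conj_apply_self V j]
        exact Finset.sum_eq_zero fun i _ => hU.normSq_mul_eq_zero hV hs hc hdom h.symm i
      simp [← h, h1]
    · rw [if_pos h, if_pos (mul_pos hb h), Real.log_mul hb.ne' h.ne']
      simp
      ring
  rw [(hU.smul a).relEnt_eq (hV.smul b), hU.relEnt_eq hV, hsum, hU.trace_re]
  simp only [hlog a _ ha (hs _), Finset.sum_add_distrib, ← Finset.mul_sum]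
  ring

theorem relEnt_zero_left {τ : Matrix ι ι ℂ} (hτ : τ.IsHermitian) : relEnt 0 τ = 0 := by
  have h : Diagonalizes (1 : Matrix ι ι ℂ) (fun _ => 0) 0 := ⟨by simp, by simp, by simp⟩
  rw [h.relEnt_eq hτ.diagonalizes]
  simp

end Diagonalization

section Instrument

variable {n m : ℕ} {Ω K : Type*} [Fintype K]

theorem probOut_eq_trace_instAct (V : Ω → K → Matrix (Fin m) (Fin n) ℂ)
    (ρ : Matrix (Fin n) (Fin n) ℂ) (ω : Ω) : probOut V ρ ω = (instAct V ω ρ).trace.re := by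
  rw [probOut, povm, instAct, Matrix.sum_mul, trace_sum, trace_sum]
  congr 1
  refine Finset.sum_congr rfl fun k _ => ?_
  rw [Matrix.mul_assoc, trace_mul_comm]

theorem instAct_posSemidef (V : Ω → K → Matrix (Fin m) (Fin n) ℂ) (ω : Ω)
    {ρ : Matrix (Fin n) (Fin n) ℂ} (hρ : ρ.PosSemidef) : (instAct V ω ρ).PosSemidef :=
  posSemidef_sum _ fun k _ => hρ.mul_mul_conjTranspose_same (V ω k)

theorem instAct_sub_smul (V : Ω → K → Matrix (Fin m) (Fin n) ℂ) (ω : Ω)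
    (η ρ : Matrix (Fin n) (Fin n) ℂ) (c : ℝ) :
    instAct V ω (η - c • ρ) = instAct V ω η - c • instAct V ω ρ := by
  simp [instAct, Matrix.mul_sub, Matrix.sub_mul, Finset.sum_sub_distrib, Finset.smul_sum]

theorem Matrix.PosSemidef.real_smul {ι : Type*} {A : Matrix ι ι ℂ}
    (hA : A.PosSemidef) {c : ℝ} (hc : 0 ≤ c) : (c • A).PosSemidef :=
  hA.smul hc

theorem re_trace_nonneg {ι : Type*} [Fintype ι] {A : Matrix ι ι ℂ} (hA : A.PosSemidef) :
    0 ≤ A.trace.re :=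
  (Complex.nonneg_iff.1 hA.trace_nonneg).1

theorem mul_probOut_le (V : Ω → K → Matrix (Fin m) (Fin n) ℂ) (ω : Ω)
    {η ρ : Matrix (Fin n) (Fin n) ℂ} {c : ℝ} (hdom : (η - c • ρ).PosSemidef) :
    c * probOut V ρ ω ≤ probOut V η ω := by
  have h := re_trace_nonneg (instAct_posSemidef V ω hdom)
  rw [instAct_sub_smul, trace_sub, trace_smul, Complex.sub_re, Complex.smul_re, smul_eq_mul] at h
  rw [probOut_eq_trace_instAct, probOut_eq_trace_instAct]
  linarith

/-- The relative entropy of the unnormalized conditional states, in terms of the a posteriori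
states. -/
theorem relEnt_instAct (V : Ω → K → Matrix (Fin m) (Fin n) ℂ) (ω : Ω)
    {η ρ : Matrix (Fin n) (Fin n) ℂ} (hη : η.PosSemidef) (hρ : ρ.PosSemidef)
    {c : ℝ} (hc : 0 < c) (hdom : (η - c • ρ).PosSemidef) :
    relEnt (instAct V ω ρ) (instAct V ω η) = if 0 < probOut V ρ ω then
      probOut V ρ ω * (relEnt (post V ω ρ) (post V ω η) +
        Real.log (probOut V ρ ω / probOut V η ω)) else 0 := by
  have hI := instAct_posSemidef V ω hρ
  have hJ := instAct_posSemidef V ω hη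
  have hIJ : (instAct V ω η - c • instAct V ω ρ).PosSemidef := by
    rw [← instAct_sub_smul]
    exact instAct_posSemidef V ω hdom
  split_ifs with h
  · have hle := mul_probOut_le V ω hdom
    have h' : 0 < probOut V η ω := (mul_pos hc h).trans_le hle
    rw [post, post, ← probOut_eq_trace_instAct, ← probOut_eq_trace_instAct,
      relEnt_smul_smul hI hJ hc hIJ (inv_pos.2 h) (inv_pos.2 h'), ← probOut_eq_trace_instAct,
      Real.log_div h.ne' h'.ne', Real.log_inv, Real.log_inv]
    field_simp
    ring
  · have h0 : (instAct V ω ρ).trace = 0 := by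
      have h1 := Complex.nonneg_iff.1 hI.trace_nonneg
      rw [probOut_eq_trace_instAct] at h
      exact Complex.ext (le_antisymm (not_lt.1 h) h1.1) h1.2.symm
    rw [hI.trace_eq_zero_iff.1 h0, relEnt_zero_left hJ.isHermitian]

theorem posSemidef_sum_sub_smul {A ι : Type*} [Fintype A] [DecidableEq A] {p : A → ℝ}
    (hp : ∀ α, 0 ≤ p α) {ρ : A → Matrix ι ι ℂ} (hρ : ∀ α, (ρ α).PosSemidef) (α : A) :
    (∑ β, p β • ρ β - p α • ρ α).PosSemidef := by
  rw [← Finset.sum_erase_eq_sub (Finset.mem_univ α)]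
  exact posSemidef_sum _ fun β _ => (hρ β).real_smul (hp β)

end Instrument

theorem lower_bound_3_38 {A Ω K : Type*} [Fintype A] [Fintype Ω] [Fintype K]
    [Nonempty A] [Nonempty Ω] [Nonempty K] {n m : ℕ} (hn : 1 ≤ n) (hm : 1 ≤ m)
    (p : A → ℝ) (hp0 : ∀ α, 0 ≤ p α) (hp1 : ∑ α, p α = 1)
    (ρ : A → Matrix (Fin n) (Fin n) ℂ) (hρ : ∀ α, IsDensityMatrix (ρ α))
    (V : Ω → K → Matrix (Fin m) (Fin n) ℂ)
    (hV : ∑ ω, ∑ k, (V ω k)ᴴ * V ω k = 1)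
    (η : Matrix (Fin n) (Fin n) ℂ) (hη : η = ∑ α, p α • ρ α)
    (Pf : Ω → ℝ) (hPf : ∀ ω, Pf ω = probOut V η ω)
    (ηf : Matrix (Fin m) (Fin m) ℂ) (hηf : ηf = ∑ ω, instAct V ω η)
    (ηfα : A → Matrix (Fin m) (Fin m) ℂ) (hηfα : ∀ α, ηfα α = ∑ ω, instAct V ω (ρ α)) :
    Ic p ρ V +
        ∑ ω, (if 0 < Pf ω then
        Pf ω * ∑ α, (if 0 < p α * probOut V (ρ α) ω then
          (p α * probOut V (ρ α) ω / Pf ω) *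
            relEnt (post V ω (ρ α)) (post V ω η)
        else 0)
      else 0)
      ≥ ∑ α, (if 0 < p α then p α * relEnt (ηfα α) ηf else 0) := by
  classical
  have hρ' : ∀ α, (ρ α).PosSemidef := fun α => (hρ α).1
  have hdom : ∀ α, (η - p α • ρ α).PosSemidef := fun α =>
    hη ▸ posSemidef_sum_sub_smul hp0 hρ' α
  have hη' : η.PosSemidef := hη ▸ posSemidef_sum _ fun α _ => (hρ' α).real_smul (hp0 α)
  have hpost : (∑ ω, if 0 < Pf ω then Pf ω * ∑ α, (if 0 < p α * probOut V (ρ α) ω then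
      (p α * probOut V (ρ α) ω / Pf ω) * relEnt (post V ω (ρ α)) (post V ω η) else 0) else 0) =
      ∑ α, ∑ ω, if 0 < p α * probOut V (ρ α) ω then
        p α * probOut V (ρ α) ω * relEnt (post V ω (ρ α)) (post V ω η) else 0 := by
    rw [Finset.sum_comm]
    refine Finset.sum_congr rfl fun ω _ => ?_
    split_ifs with h
    · rw [Finset.mul_sum]
      refine Finset.sum_congr rfl fun α _ => ?_
      split_ifs
      · field_simp
      · simp
    · refine (Finset.sum_eq_zero fun α _ => if_neg fun h' => h ?_).symm
      rw [hPf]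
      exact h'.trans_le (mul_probOut_le V ω (hdom α))
  rw [ge_iff_le, hpost, Ic, ← hη, ← Finset.sum_add_distrib]
  refine Finset.sum_le_sum fun α _ => ?_
  rw [← Finset.sum_add_distrib]
  split_ifs with hα
  · have hsub := relEnt_sum_le (fun ω => instAct_posSemidef V ω (hρ' α))
      (fun ω => instAct_posSemidef V ω hη') hα
      (fun ω => instAct_sub_smul V ω η (ρ α) (p α) ▸ instAct_posSemidef V ω (hdom α))
    rw [← hηf, ← hηfα] at hsub
    refine (mul_le_mul_of_nonneg_left hsub hα.le).trans_eq ?_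
    rw [Finset.mul_sum]
    refine Finset.sum_congr rfl fun ω _ => ?_
    rw [relEnt_instAct V ω hη' (hρ' α) hα (hdom α)]
    simp only [mul_pos_iff_of_pos_left hα, mul_div_mul_left _ _ hα.ne']
    split_ifs
    · ring
    · simp
  · have h0 : p α = 0 := le_antisymm (not_lt.1 hα) (hp0 α)
    simp [h0]

end
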